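/- arXiv:math/0602410 — 3 statements merged into one kernel-verified Lean document; each statement's English description precedes it below -/
import Mathlib

section
/- Let m ≥ 2 be an integer and c any real constant. Define A(s) = (∫₀^s (sinh t)^(m-1) dt)/(sinh s)^(m-1) for s > 0 and A(0) = 0, and define f : B^m → ℝ on the open unit ball B^m ⊂ ℝ^m by f(x) = ∫₀^{r(x)} c·A(s)/√(1 + c²·A(s)²) ds, where r(x) = log((1 + ‖x‖)/(1 − ‖x‖)). Then f is a C^∞ (infinitely differentiable) function on B^m. -/
open Real Set MeasureTheory Filter Topology

/-- The hyperbolic distance to the origin, as a function of the Euclidean norm. -/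
noncomputable def poincareRadius (u : ℝ) : ℝ := log ((1 + u) / (1 - u))

lemma poincareRadius_zero : poincareRadius 0 = 0 := by simp [poincareRadius]

lemma one_sub_sq_pos {u : ℝ} (h0 : 0 ≤ u) (h1 : u < 1) : 0 < 1 - u ^ 2 := by nlinarith

lemma hasDerivAt_poincareRadius {u : ℝ} (h0 : 0 ≤ u) (h1 : u < 1) :
    HasDerivAt poincareRadius (2 / (1 - u ^ 2)) u := by
  have hp : (1 + u) ≠ 0 := by linarith
  have hm : (1 - u) ≠ 0 := by linarith
  have hq := (one_sub_sq_pos h0 h1).ne'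
  have h := (((hasDerivAt_id u).const_add 1).div ((hasDerivAt_id u).const_sub 1) hm).log
    (div_ne_zero hp hm)
  refine h.congr_deriv ?_
  simp only [id]
  have : 1 - u ^ 2 = (1 + u) * (1 - u) := by ring
  rw [this]
  simp only [Pi.div_apply]
  field_simp
  ring

lemma sinh_poincareRadius {u : ℝ} (h0 : 0 ≤ u) (h1 : u < 1) :
    sinh (poincareRadius u) = 2 * u / (1 - u ^ 2) := by
  have hp : (1 + u) ≠ 0 := by linarith
  have hm : (1 - u) ≠ 0 := by linarith
  have hpos : 0 < (1 + u) / (1 - u) := div_pos (by linarith) (by linarith)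
  have : 1 - u ^ 2 = (1 + u) * (1 - u) := by ring
  rw [poincareRadius, sinh_log hpos, this]
  field_simp
  ring

lemma poincareRadius_pos {u : ℝ} (h0 : 0 < u) (h1 : u < 1) : 0 < poincareRadius u :=
  log_pos <| (one_lt_div (by linarith)).2 (by linarith)

/-- The integral `∫₀¹ vᵃ / (1 - q v²)ᵇ dv`. -/
noncomputable def betaKernel (a b : ℕ) (q : ℝ) : ℝ :=
  ∫ v in (0:ℝ)..1, v ^ a / (1 - q * v ^ 2) ^ b

lemma le_one_sub_mul_sq {q p v : ℝ} (hq : q ≤ p) (h0 : 0 ≤ v) (h1 : v ≤ 1) :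
    min 1 (1 - p) ≤ 1 - q * v ^ 2 := by
  have hv : v ^ 2 ≤ 1 := by nlinarith
  have hv' := sq_nonneg v
  rcases le_total q 0 with h | h
  · exact (min_le_left _ _).trans (by nlinarith)
  · exact (min_le_right _ _).trans (by nlinarith)

lemma one_sub_mul_sq_pos {q v : ℝ} (hq : q < 1) (h0 : 0 ≤ v) (h1 : v ≤ 1) :
    0 < 1 - q * v ^ 2 :=
  (lt_min one_pos (sub_pos.2 hq)).trans_le (le_one_sub_mul_sq le_rfl h0 h1)

lemma continuousOn_betaKernel_integrand (a b : ℕ) {q : ℝ} (hq : q < 1) :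
    ContinuousOn (fun v : ℝ => v ^ a / (1 - q * v ^ 2) ^ b) (Icc 0 1) := by
  refine ContinuousOn.div (by fun_prop) (by fun_prop) fun v hv => ?_
  exact pow_ne_zero _ (one_sub_mul_sq_pos hq hv.1 hv.2).ne'

lemma aestronglyMeasurable_betaKernel_integrand (a b : ℕ) {q : ℝ} (hq : q < 1) :
    AEStronglyMeasurable (fun v : ℝ => v ^ a / (1 - q * v ^ 2) ^ b)
      (volume.restrict (uIoc 0 1)) := by
  rw [uIoc_of_le zero_le_one]
  exact ((continuousOn_betaKernel_integrand a b hq).mono Ioc_subset_Icc_self).aestronglyMeasurable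
    measurableSet_Ioc

lemma hasDerivAt_betaKernel (a b : ℕ) {q : ℝ} (hq : q < 1) :
    HasDerivAt (betaKernel a b) (b * betaKernel (a + 2) (b + 1) q) q := by
  obtain ⟨p, hqp, hp⟩ := exists_between hq
  set δ := min 1 (1 - p)
  have hδ : 0 < δ := lt_min one_pos (sub_pos.2 hp)
  have key := intervalIntegral.hasDerivAt_integral_of_dominated_loc_of_deriv_le
    (μ := volume) (a := 0) (b := 1)
    (F := fun q v : ℝ => v ^ a / (1 - q * v ^ 2) ^ b)
    (F' := fun q v : ℝ => b * (v ^ (a + 2) / (1 - q * v ^ 2) ^ (b + 1)))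
    (bound := fun _ => b * (1 / δ ^ (b + 1))) (x₀ := q) (Iio_mem_nhds hqp)
    ?_ ?_ ?_ ?_ ?_ ?_
  · refine key.2.congr_deriv ?_
    rw [intervalIntegral.integral_const_mul, betaKernel]
  · filter_upwards [Iio_mem_nhds hq] with x hx
    exact aestronglyMeasurable_betaKernel_integrand a b hx
  · exact (by simpa using continuousOn_betaKernel_integrand a b hq :
      ContinuousOn _ (uIcc (0:ℝ) 1)).intervalIntegrable
  · exact (aestronglyMeasurable_betaKernel_integrand (a + 2) (b + 1) hq).const_mul _
  · refine Eventually.of_forall fun v hv x hx => ?_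
    rw [uIoc_of_le zero_le_one] at hv
    have h := le_one_sub_mul_sq (le_of_lt hx) hv.1.le hv.2
    have h' : 0 < 1 - x * v ^ 2 := hδ.trans_le h
    have hv0 := hv.1.le
    rw [Real.norm_of_nonneg (by positivity)]
    gcongr
    exact pow_le_one₀ hv0 hv.2
  · exact intervalIntegrable_const
  · refine Eventually.of_forall fun v hv x hx => ?_
    rw [uIoc_of_le zero_le_one] at hv
    have h' : (1 - x * v ^ 2) ≠ 0 :=
      (one_sub_mul_sq_pos (lt_trans hx hp) hv.1.le hv.2).ne'
    have h := ((((hasDerivAt_id x).mul_const (v ^ 2)).const_sub 1).pow b).inv (pow_ne_zero b h')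
    refine ((h.const_mul (v ^ a)).congr_deriv ?_).congr_of_eventuallyEq
      (Eventually.of_forall fun y => by simp [div_eq_mul_inv])
    simp only [Pi.pow_apply, id]
    rcases b with _ | b
    · simp
    · simp only [Nat.add_sub_cancel]
      field_simp
      ring

lemma contDiffOn_betaKernel (n : ℕ) (a b : ℕ) : ContDiffOn ℝ n (betaKernel a b) (Iio 1) := by
  induction n generalizing a b with
  | zero =>
    exact contDiffOn_zero.2 fun q hq => (hasDerivAt_betaKernel a b hq).continuousAt.continuousWithinAt
  | succ n ih =>
    push_cast
    refine (contDiffOn_succ_iff_deriv_of_isOpen isOpen_Iio).2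
      ⟨fun q hq => (hasDerivAt_betaKernel a b hq).differentiableAt.differentiableWithinAt,
        by simp, ?_⟩
    exact (contDiffOn_const.mul (ih (a + 2) (b + 1))).congr
      fun q hq => (hasDerivAt_betaKernel a b hq).deriv

lemma ContDiffOn.integral_of_isOpen {g : ℝ → ℝ} {U : Set ℝ} (hU : IsOpen U) (hc : U.OrdConnected)
    (h0 : (0:ℝ) ∈ U) (hg : ContDiffOn ℝ (⊤ : ℕ∞) g U) :
    ContDiffOn ℝ (⊤ : ℕ∞) (fun q => ∫ t in (0:ℝ)..q, g t) U := by
  have hd : ∀ q ∈ U, HasDerivAt (fun q => ∫ t in (0:ℝ)..q, g t) (g q) q := fun q hq =>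
    intervalIntegral.integral_hasDerivAt_right
      (hg.continuousOn.mono (hc.uIcc_subset h0 hq)).intervalIntegrable
      (hg.continuousOn.stronglyMeasurableAtFilter hU q hq)
      (hg.continuousOn.continuousAt (hU.mem_nhds hq))
  exact (contDiffOn_infty_iff_deriv_of_isOpen hU).2
    ⟨fun q hq => (hd q hq).differentiableAt.differentiableWithinAt,
      hg.congr fun q hq => (hd q hq).deriv⟩

lemma integral_sinh_pow_poincareRadius (k : ℕ) {u : ℝ} (h0 : 0 ≤ u) (h1 : u < 1) :
    ∫ t in (0:ℝ)..poincareRadius u, sinh t ^ k =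
      (2 * u) ^ (k + 1) * betaKernel k (k + 1) (u ^ 2) := by
  have hbd : ∀ v ∈ uIcc (0:ℝ) 1, 0 ≤ u * v ∧ u * v < 1 := fun v hv => by
    rw [uIcc_of_le zero_le_one] at hv
    exact ⟨mul_nonneg h0 hv.1, by nlinarith [hv.1, hv.2]⟩
  have key := intervalIntegral.integral_comp_mul_deriv (a := 0) (b := 1)
    (f := fun v => poincareRadius (u * v)) (f' := fun v => 2 / (1 - (u * v) ^ 2) * u)
    (g := fun t => sinh t ^ k)
    (fun v hv => by
      simpa [Function.comp_def] using (hasDerivAt_poincareRadius (hbd v hv).1 (hbd v hv).2).comp v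
        ((hasDerivAt_id v).const_mul u))
    (by
      refine ContinuousOn.mul (ContinuousOn.div (by fun_prop) (by fun_prop) fun v hv => ?_)
        (by fun_prop)
      exact (one_sub_sq_pos (hbd v hv).1 (hbd v hv).2).ne')
    (by fun_prop)
  simp only [mul_zero, mul_one, poincareRadius_zero] at key
  rw [← key, betaKernel, ← intervalIntegral.integral_const_mul]
  refine intervalIntegral.integral_congr fun v hv => ?_
  have h := (one_sub_sq_pos (hbd v hv).1 (hbd v hv).2).ne'
  simp only [Function.comp, sinh_poincareRadius (hbd v hv).1 (hbd v hv).2]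
  rw [← mul_pow u v 2]
  generalize 1 - (u * v) ^ 2 = D at h ⊢
  rw [← mul_assoc 2 u v, div_pow, mul_pow (2 * u), pow_succ, pow_succ]
  field_simp

/-- The smooth factor `H` in `A (r u) = u * H (u ^ 2)`, where `r` is `poincareRadius`. -/
noncomputable def radialFactor (k : ℕ) (q : ℝ) : ℝ :=
  2 * (1 - q) ^ k * betaKernel k (k + 1) q

lemma integral_sinh_pow_div_sinh_pow (k : ℕ) {u : ℝ} (h0 : 0 < u) (h1 : u < 1) :
    (∫ t in (0:ℝ)..poincareRadius u, sinh t ^ k) / sinh (poincareRadius u) ^ k =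
      u * radialFactor k (u ^ 2) := by
  have h := (one_sub_sq_pos h0.le h1).ne'
  rw [integral_sinh_pow_poincareRadius k h0.le h1, sinh_poincareRadius h0.le h1, radialFactor,
    div_pow, pow_succ]
  field_simp

lemma contDiffOn_radialFactor (k : ℕ) : ContDiffOn ℝ (⊤ : ℕ∞) (radialFactor k) (Iio 1) :=
  ContDiffOn.mul (by fun_prop) (contDiffOn_infty.2 fun n => contDiffOn_betaKernel n _ _)

/-- The density with respect to `q = ‖x‖ ^ 2` of the integral defining the graphing function. -/
noncomputable def slopeDensity (c : ℝ) (k : ℕ) (q : ℝ) : ℝ :=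
  c * radialFactor k q / (√(1 + c ^ 2 * (q * radialFactor k q ^ 2)) * (1 - q))

lemma contDiffOn_slopeDensity (c : ℝ) (k : ℕ) :
    ∃ ε > 0, ContDiffOn ℝ (⊤ : ℕ∞) (slopeDensity c k) (Ioo (-ε) 1) := by
  have hH := contDiffOn_radialFactor k
  have hcont : ContinuousAt (fun q => 1 + c ^ 2 * (q * radialFactor k q ^ 2)) 0 := by
    have := hH.continuousOn.continuousAt (Iio_mem_nhds (zero_lt_one' ℝ))
    fun_prop
  have hev : ∀ᶠ q in 𝓝 (0:ℝ), 0 < 1 + c ^ 2 * (q * radialFactor k q ^ 2) :=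
    hcont.eventually (lt_mem_nhds (by simp))
  obtain ⟨ε, hε, hball⟩ := Metric.eventually_nhds_iff.1 hev
  refine ⟨ε, hε, ?_⟩
  have hH' : ContDiffOn ℝ (⊤ : ℕ∞) (radialFactor k) (Ioo (-ε) 1) := hH.mono fun q hq => hq.2
  have hpos : ∀ q ∈ Ioo (-ε) 1, 0 < 1 + c ^ 2 * (q * radialFactor k q ^ 2) := fun q hq => by
    rcases lt_or_ge q 0 with h | h
    · refine hball ?_
      rw [dist_zero_right, Real.norm_eq_abs, abs_of_neg h]
      linarith [hq.1]
    · positivity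
  refine (contDiffOn_const.mul hH').div (ContDiffOn.mul (ContDiffOn.sqrt ?_ fun q hq =>
    (hpos q hq).ne') (by fun_prop)) fun q hq => ?_
  · exact contDiffOn_const.add (contDiffOn_const.mul (contDiffOn_id.mul (hH'.pow 2)))
  · exact mul_ne_zero (sqrt_pos.2 (hpos q hq)).ne' (sub_pos.2 hq.2).ne'

lemma integral_poincareRadius_eq_integral_sq {g G : ℝ → ℝ} {ρ : ℝ} (h0 : 0 ≤ ρ) (h1 : ρ < 1)
    (h : ∀ u, 0 < u → u < 1 → g (poincareRadius u) * (2 / (1 - u ^ 2)) = G (u ^ 2) * (2 * u)) :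
    ∫ s in (0:ℝ)..poincareRadius ρ, g s = ∫ q in (0:ℝ)..ρ ^ 2, G q := by
  have e1 := intervalIntegral.integral_comp_mul_deriv_of_deriv_nonneg (a := 0) (b := ρ) (g := g)
    (f := poincareRadius) (f' := fun u => 2 / (1 - u ^ 2))
    (fun u hu => by
      rw [uIcc_of_le h0] at hu
      exact (hasDerivAt_poincareRadius hu.1 (hu.2.trans_lt h1)).continuousAt.continuousWithinAt)
    (fun u hu => by
      simp only [h0, min_eq_left, max_eq_right] at hu
      exact hasDerivAt_poincareRadius hu.1.le (hu.2.trans h1))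
    (fun u hu => by
      simp only [h0, min_eq_left, max_eq_right] at hu
      exact div_nonneg zero_le_two (one_sub_sq_pos hu.1.le (hu.2.trans h1)).le)
  have e2 := intervalIntegral.integral_comp_mul_deriv_of_deriv_nonneg (a := 0) (b := ρ) (g := G)
    (f := fun u => u ^ 2) (f' := fun u => 2 * u)
    (by fun_prop)
    (fun u _ => by simpa using hasDerivAt_pow 2 u)
    (fun u hu => by
      simp only [h0, min_eq_left, max_eq_right] at hu
      linarith [hu.1])
  simp only [ne_eq, OfNat.ofNat_ne_zero, not_false_eq_true, zero_pow] at e2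
  rw [poincareRadius_zero] at e1
  rw [← e1, ← e2]
  refine intervalIntegral.integral_congr_ae (Eventually.of_forall fun u hu => ?_)
  rw [uIoc_of_le h0] at hu
  exact h u hu.1 (hu.2.trans_lt h1)


/-- For `m ≥ 2` and any real `c`, the function
`f x = ∫₀^{r(x)} c A s/√(1 + c²A s²) ds`, where
`A s = (∫₀^s (sinh t)^(m-1) dt)/(sinh s)^(m-1)` (with `A 0 = 0`) and
`r(x) = log((1+‖x‖)/(1-‖x‖))`, is `C^∞` on the open unit ball of `ℝ^m`. -/
theorem stmt_16 (m : ℕ) (hm : 2 ≤ m) (c : ℝ)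
    (A : ℝ → ℝ) (hA0 : A 0 = 0)
    (hA : ∀ s : ℝ, 0 < s → A s =
      (∫ t in (0:ℝ)..s, Real.sinh t ^ (m - 1)) / Real.sinh s ^ (m - 1))
    (f : EuclideanSpace ℝ (Fin m) → ℝ)
    (hf : ∀ x : EuclideanSpace ℝ (Fin m), ‖x‖ < 1 →
      f x = ∫ s in (0:ℝ)..(Real.log ((1 + ‖x‖) / (1 - ‖x‖))),
        c * A s / Real.sqrt (1 + c ^ 2 * A s ^ 2)) :
    ContDiffOn ℝ (⊤ : ℕ∞) f (Metric.ball 0 1) := by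
  obtain ⟨k, rfl⟩ : ∃ k, m = k + 1 := ⟨m - 1, by omega⟩
  simp only [Nat.add_sub_cancel] at hA
  obtain ⟨ε, hε, hG⟩ := contDiffOn_slopeDensity c k
  have hF := hG.integral_of_isOpen isOpen_Ioo ordConnected_Ioo ⟨by linarith, one_pos⟩
  have hnorm : ContDiffOn ℝ (⊤ : ℕ∞) (fun x : EuclideanSpace ℝ (Fin (k + 1)) => ‖x‖ ^ 2)
      (Metric.ball 0 1) := (contDiff_norm_sq ℝ).contDiffOn
  refine (hF.comp hnorm fun x hx => ?_).congr fun x hx => ?_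
  · rw [mem_ball_zero_iff] at hx
    exact ⟨by linarith [sq_nonneg ‖x‖], by nlinarith [norm_nonneg x]⟩
  · rw [mem_ball_zero_iff] at hx
    rw [hf x hx]
    refine integral_poincareRadius_eq_integral_sq (norm_nonneg x) hx fun u h0 h1 => ?_
    have hu := (one_sub_sq_pos h0.le h1).ne'
    rw [hA _ (poincareRadius_pos h0 h1), integral_sinh_pow_div_sinh_pow k h0 h1, slopeDensity,
      mul_pow u]
    field_simp
end

section
/- Let m ≥ 1 be an integer, R > 0, c > 0, and let f : ℝ^m → ℝ be a C² function such that the divergence div(∇f/√(1 + ‖∇f‖²)) (x) ≥ m·c for every x in the closed Euclidean ball of radius R centred at 0. Then c ≤ 1/R. Consequently, if f : ℝ^m → ℝ is C² and div(∇f/√(1 + ‖∇f‖²)) is equal to a constant K on all of ℝ^m, then K = 0, i.e. the graph of f is a minimal hypersurface of ℝ^{m+1}. -/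
open scoped BigOperators
open MeasureTheory

/-- A `C¹` field on Euclidean space whose divergence is positive on a ball of radius `R` and
which points inward wherever `r ≤ ‖x‖`, with `r < R`, cannot exist. -/
theorem false_of_div_pos_of_inner_nonpos {m : ℕ} {r R : ℝ} (hr : 0 ≤ r) (hrR : r < R)
    {Z : EuclideanSpace ℝ (Fin m) → EuclideanSpace ℝ (Fin m)} (hZ : ContDiff ℝ 1 Z)
    (hin : ∀ x, r ≤ ‖x‖ → inner ℝ x (Z x) ≤ 0)
    (hdiv : ∀ x ∈ Metric.closedBall (0 : EuclideanSpace ℝ (Fin m)) R,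
      0 < ∑ i : Fin m, fderiv ℝ Z x (EuclideanSpace.single i 1) i) : False := by
  have hδ : 0 < R ^ 2 - r ^ 2 := by nlinarith
  set q : EuclideanSpace ℝ (Fin m) → ℝ := fun x => (R ^ 2 - ‖x‖ ^ 2) / (R ^ 2 - r ^ 2) with hq
  set φ : EuclideanSpace ℝ (Fin m) → ℝ := fun x => Real.smoothTransition (q x) with hφ
  have hs : ContDiff ℝ 1 Real.smoothTransition := Real.smoothTransition.contDiff
  have hφ1 : ContDiff ℝ 1 φ :=
    hs.comp ((contDiff_const.sub (contDiff_norm_sq ℝ)).div_const _)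
  have hφ0 : ∀ x, x ∉ Metric.closedBall (0 : EuclideanSpace ℝ (Fin m)) R → φ x = 0 := by
    intro x hx
    rw [mem_closedBall_zero_iff, not_le] at hx
    apply Real.smoothTransition.zero_of_nonpos
    apply div_nonpos_of_nonpos_of_nonneg _ hδ.le
    nlinarith [norm_nonneg x]
  have hφc : HasCompactSupport φ :=
    HasCompactSupport.intro (isCompact_closedBall (0 : EuclideanSpace ℝ (Fin m)) R) hφ0
  have hφd : Differentiable ℝ φ := hφ1.differentiable one_ne_zero
  have hZi : ∀ i, ContDiff ℝ 1 (fun x => Z x i) := fun i =>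
    (EuclideanSpace.proj (𝕜 := ℝ) i).contDiff.comp hZ
  have hZf : ∀ i x v, fderiv ℝ (fun x => Z x i) x v = fderiv ℝ Z x v i := by
    intro i x v
    have h := ((EuclideanSpace.proj (𝕜 := ℝ) i).hasFDerivAt.comp x
      (hZ.differentiable one_ne_zero x).hasFDerivAt).fderiv
    exact congrArg (fun L => L v) h
  have hZc : ∀ i, Continuous fun x => fderiv ℝ Z x (EuclideanSpace.single i 1) i := by
    intro i
    simp only [← hZf]
    exact ((hZi i).continuous_fderiv one_ne_zero).clm_apply continuous_const
  have hdφc : ∀ i : Fin m, Continuous fun x => fderiv ℝ φ x (EuclideanSpace.single i 1) :=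
    fun i => (hφ1.continuous_fderiv one_ne_zero).clm_apply continuous_const
  have hdφs : ∀ i : Fin m,
      HasCompactSupport fun x => fderiv ℝ φ x (EuclideanSpace.single i 1) :=
    fun i => hφc.fderiv_apply ℝ _
  have hintL : ∀ i : Fin m,
      Integrable fun x => φ x * fderiv ℝ Z x (EuclideanSpace.single i 1) i := fun i =>
    (hφ1.continuous.mul (hZc i)).integrable_of_hasCompactSupport hφc.mul_right
  have hintR : ∀ i : Fin m,
      Integrable fun x => fderiv ℝ φ x (EuclideanSpace.single i 1) * Z x i := fun i =>
    ((hdφc i).mul (hZi i).continuous).integrable_of_hasCompactSupport (hdφs i).mul_right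
  have hparts : ∀ i : Fin m,
      ∫ x, φ x * fderiv ℝ Z x (EuclideanSpace.single i 1) i =
        -∫ x, fderiv ℝ φ x (EuclideanSpace.single i 1) * Z x i := by
    intro i
    have h := integral_mul_fderiv_eq_neg_fderiv_mul_of_integrable (𝕜 := ℝ)
      (μ := (volume : Measure (EuclideanSpace ℝ (Fin m)))) (f := φ) (g := fun x => Z x i)
      (v := EuclideanSpace.single i 1) (hintR i) (by simpa only [hZf] using hintL i)
      ((hφ1.continuous.mul (hZi i).continuous).integrable_of_hasCompactSupport hφc.mul_right)
      (fun x _ => hφd x) (fun x _ => (hZi i).differentiable one_ne_zero x)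
    simpa only [hZf] using h
  have hsum : ∀ x, ∑ i : Fin m, fderiv ℝ φ x (EuclideanSpace.single i 1) * Z x i
      = fderiv ℝ φ x (Z x) := by
    intro x
    conv_rhs => rw [← (EuclideanSpace.basisFun (Fin m) ℝ).sum_repr (Z x)]
    simp [mul_comm]
  have hflux : ∀ x, 0 ≤ fderiv ℝ φ x (Z x) := by
    intro x
    have hqd : HasFDerivAt q ((R ^ 2 - r ^ 2)⁻¹ • (-((2 : ℝ) • innerSL ℝ x))) x := by
      have h := ((hasStrictFDerivAt_norm_sq x).hasFDerivAt.const_sub (R ^ 2)).const_mul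
        (R ^ 2 - r ^ 2)⁻¹
      simpa only [hq, div_eq_inv_mul, two_smul] using h
    have hd := ((hs.differentiable one_ne_zero (q x)).hasDerivAt.comp_hasFDerivAt x hqd).fderiv
    have hd' : fderiv ℝ φ x = _ := hd
    rcases le_or_gt r ‖x‖ with hx | hx
    · rw [hd']
      have h0 : 0 ≤ deriv Real.smoothTransition (q x) := Real.smoothTransition.monotone.deriv_nonneg
      have h1 := hin x hx
      have h2 : 0 ≤ (R ^ 2 - r ^ 2)⁻¹ := by positivity
      have : 0 ≤ deriv Real.smoothTransition (q x) *
          ((R ^ 2 - r ^ 2)⁻¹ * (-(2 * inner ℝ x (Z x)))) := by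
        apply mul_nonneg h0 (mul_nonneg h2 _)
        linarith
      simpa using this
    · have : φ =ᶠ[nhds x] fun _ => 1 := by
        filter_upwards [(isOpen_lt continuous_norm continuous_const).mem_nhds hx] with y hy
        apply Real.smoothTransition.one_of_one_le
        rw [one_le_div hδ]
        have hy' : ‖y‖ < r := hy
        nlinarith [norm_nonneg y]
      rw [this.fderiv_eq]
      simp
  have hle : ∫ x, φ x * ∑ i : Fin m, fderiv ℝ Z x (EuclideanSpace.single i 1) i ≤ 0 := by
    simp only [Finset.mul_sum]
    rw [integral_finsetSum _ fun i _ => hintL i]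
    simp only [hparts]
    rw [Finset.sum_neg_distrib, ← integral_finsetSum _ fun i _ => hintR i]
    simp only [hsum]
    exact neg_nonpos.2 (integral_nonneg hflux)
  refine hle.not_gt ?_
  have hφ00 : φ 0 = 1 := by
    apply Real.smoothTransition.one_of_one_le
    rw [one_le_div hδ]
    simp only [norm_zero]
    nlinarith
  refine Continuous.integral_pos_of_hasCompactSupport_nonneg_nonzero (x := 0)
    (hφ1.continuous.mul (continuous_finsetSum _ fun i _ => hZc i)) hφc.mul_right ?_ ?_
  · intro x
    by_cases hx : x ∈ Metric.closedBall (0 : EuclideanSpace ℝ (Fin m)) R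
    · exact mul_nonneg (Real.smoothTransition.nonneg _) (hdiv x hx).le
    · simp [hφ0 x hx]
  · rw [hφ00, one_mul]
    exact ne_of_gt (hdiv 0 (Metric.mem_closedBall_self (hr.trans hrR.le)))

/-- The isoperimetric bound on a ball: a `C¹` field of norm at most one whose divergence is at
least `m c` on a ball of radius `R` in `ℝ^m` has `c ≤ 1 / R`. -/
theorem le_one_div_of_mul_le_div {m : ℕ} (hm : 1 ≤ m) {R c : ℝ} (hR : 0 < R)
    {X : EuclideanSpace ℝ (Fin m) → EuclideanSpace ℝ (Fin m)} (hX : ContDiff ℝ 1 X)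
    (hX1 : ∀ x, ‖X x‖ ≤ 1)
    (hdiv : ∀ x ∈ Metric.closedBall (0 : EuclideanSpace ℝ (Fin m)) R,
      (m : ℝ) * c ≤ ∑ i : Fin m, fderiv ℝ X x (EuclideanSpace.single i 1) i) :
    c ≤ 1 / R := by
  by_contra! hcR
  obtain ⟨a, ha, hac⟩ := exists_between hcR
  have ha0 : 0 < a := (one_div_pos.2 hR).trans ha
  have hm0 : (0 : ℝ) < m := by exact_mod_cast hm
  refine false_of_div_pos_of_inner_nonpos (r := 1 / a) (R := R) (Z := fun x => X x - a • x)
    (by positivity) ((one_div_lt ha0 hR).2 ha) (hX.sub (contDiff_id.const_smul a)) ?_ ?_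
  · intro x hx
    have h1 : inner ℝ x (X x) ≤ ‖x‖ * 1 :=
      (real_inner_le_norm _ _).trans (mul_le_mul_of_nonneg_left (hX1 x) (norm_nonneg x))
    rw [div_le_iff₀ ha0] at hx
    rw [inner_sub_right, inner_smul_right, real_inner_self_eq_norm_sq]
    nlinarith [norm_nonneg x]
  · intro x hx
    have hd : fderiv ℝ (fun x => X x - a • x) x
        = fderiv ℝ X x - a • ContinuousLinearMap.id ℝ _ :=
      ((hX.differentiable one_ne_zero x).hasFDerivAt.sub
        ((hasFDerivAt_id x).const_smul a)).fderiv
    have := hdiv x hx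
    rw [hd]
    simp only [sub_apply, smul_apply,
      ContinuousLinearMap.id_apply, PiLp.sub_apply, PiLp.smul_apply, PiLp.single_apply,
      if_true, smul_eq_mul, mul_one, Finset.sum_sub_distrib, Finset.sum_const, Finset.card_univ,
      Fintype.card_fin, nsmul_eq_mul]
    nlinarith

/-- The field `∇f / √(1 + ‖∇f‖²)` of a `C²` function is `C¹`. -/
theorem contDiff_normalized_gradient {m : ℕ} {f : EuclideanSpace ℝ (Fin m) → ℝ}
    (hf : ContDiff ℝ 2 f) :
    ContDiff ℝ 1 (fun y : EuclideanSpace ℝ (Fin m) =>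
      (1 / Real.sqrt (1 + ‖gradient f y‖ ^ 2)) • gradient f y) := by
  have hg : ContDiff ℝ 1 (gradient f) :=
    (InnerProductSpace.toDual ℝ (EuclideanSpace ℝ (Fin m))).symm.contDiff.comp
      (hf.fderiv_right (by norm_num))
  have hpos : ∀ y, 0 < 1 + ‖gradient f y‖ ^ 2 := fun y => by positivity
  exact (contDiff_const.div ((contDiff_const.add (hg.norm_sq ℝ)).sqrt fun y => (hpos y).ne')
    fun y => (Real.sqrt_pos.2 (hpos y)).ne').smul hg

/-- Normalizing `v` by `√(1 + ‖v‖²)` gives a vector of norm at most one. -/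
theorem norm_one_div_sqrt_smul_le_one {E : Type*} [NormedAddCommGroup E] [NormedSpace ℝ E]
    (v : E) : ‖(1 / Real.sqrt (1 + ‖v‖ ^ 2)) • v‖ ≤ 1 := by
  have hpos : 0 < Real.sqrt (1 + ‖v‖ ^ 2) := Real.sqrt_pos.2 (by positivity)
  rw [norm_smul, Real.norm_of_nonneg (by positivity), one_div_mul_eq_div, div_le_one hpos]
  exact Real.le_sqrt_of_sq_le (by linarith)

/-- A `C¹` field of norm at most one on `ℝ^m` with constant divergence `K` has `K ≤ 0`. -/
theorem nonpos_of_div_eq_const {m : ℕ} (hm : 1 ≤ m) {K : ℝ}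
    {X : EuclideanSpace ℝ (Fin m) → EuclideanSpace ℝ (Fin m)} (hX : ContDiff ℝ 1 X)
    (hX1 : ∀ x, ‖X x‖ ≤ 1)
    (hdiv : ∀ x, ∑ i : Fin m, fderiv ℝ X x (EuclideanSpace.single i 1) i = K) : K ≤ 0 := by
  by_contra! hK
  have hm0 : (0 : ℝ) < m := by exact_mod_cast hm
  have h := le_one_div_of_mul_le_div hm (R := 2 * m / K) (c := K / m) (by positivity) hX hX1
    (fun x _ => by rw [hdiv x, mul_div_cancel₀ _ hm0.ne'])
  rw [one_div_div, div_le_div_iff₀ hm0 (by positivity)] at h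
  nlinarith [mul_pos hK hm0]

/-- Heinz–Chern–Flanders: if `f : ℝ^m → ℝ` is `C²` and
`div(∇f/√(1+‖∇f‖²)) ≥ m c > 0` on the closed ball of radius `R` about `0`, then
`c ≤ 1/R`. Consequently, an entire `C²` graph with
`div(∇g/√(1+‖∇g‖²))` constant equal to `K` has `K = 0`, i.e. it is minimal. -/
theorem stmt_18 (m : ℕ) (hm : 1 ≤ m) (R c : ℝ) (hR : 0 < R) (hc : 0 < c)
    (f : EuclideanSpace ℝ (Fin m) → ℝ) (hf : ContDiff ℝ 2 f)
    (hdiv : ∀ x ∈ Metric.closedBall (0 : EuclideanSpace ℝ (Fin m)) R,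
      (m : ℝ) * c ≤ ∑ i : Fin m,
        fderiv ℝ (fun y : EuclideanSpace ℝ (Fin m) =>
            (1 / Real.sqrt (1 + ‖gradient f y‖ ^ 2)) • gradient f y)
          x (EuclideanSpace.single i 1) i) :
    c ≤ 1 / R ∧
      ∀ (g : EuclideanSpace ℝ (Fin m) → ℝ) (K : ℝ), ContDiff ℝ 2 g →
        (∀ x : EuclideanSpace ℝ (Fin m),
          (∑ i : Fin m,
            fderiv ℝ (fun y : EuclideanSpace ℝ (Fin m) =>
                (1 / Real.sqrt (1 + ‖gradient g y‖ ^ 2)) • gradient g y)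
              x (EuclideanSpace.single i 1) i) = K) →
        K = 0 := by
  refine ⟨le_one_div_of_mul_le_div hm hR (contDiff_normalized_gradient hf)
    (fun _ => norm_one_div_sqrt_smul_le_one _) hdiv, fun g K hg hK => le_antisymm ?_ ?_⟩
  · exact nonpos_of_div_eq_const hm (contDiff_normalized_gradient hg)
      (fun _ => norm_one_div_sqrt_smul_le_one _) hK
  · refine neg_nonpos.1 (nonpos_of_div_eq_const hm (contDiff_normalized_gradient hg).neg
      (fun _ => by rw [norm_neg]; exact norm_one_div_sqrt_smul_le_one _) fun x => ?_)
    rw [fderiv_fun_neg, ← hK x]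
    simp only [neg_apply, PiLp.neg_apply, Finset.sum_neg_distrib]
end

section
/- Let m ≥ 1 be an integer, R > 0, c > 0, 0 ≤ b < 1, and let f : ℝ^m → ℝ be a C² function with ‖∇f(x)‖ ≤ b for all x in the closed Euclidean ball B̄_R of radius R centred at 0 (so that the graph of f is spacelike there), and suppose div(∇f/√(1 − ‖∇f‖²)) (x) ≥ m·c for every x ∈ B̄_R. Then c ≤ b/(R·√(1 − b²)). Consequently, if f : ℝ^m → ℝ is C² with sup_{ℝ^m} ‖∇f‖ ≤ b < 1 and div(∇f/√(1 − ‖∇f‖²)) is equal to a constant K on all of ℝ^m, then K = 0, i.e. the graph of f is a maximal (mean-curvature-zero) spacelike hypersurface of Minkowski space ℝ^{m+1}_1. -/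
open scoped BigOperators

open scoped InnerProductSpace Topology

section Hessian

variable {E : Type*} [NormedAddCommGroup E] [InnerProductSpace ℝ E] [CompleteSpace E]

/-- The Hessian, written as the derivative of the gradient field, is negative semidefinite at an
interior local maximum. -/
theorem IsLocalMax.inner_fderiv_gradient_nonpos {w : E → ℝ} {G : E → E} {D : E →L[ℝ] E} {x : E}
    (hmax : IsLocalMax w x) (hw : ∀ y, HasGradientAt w (G y) y) (hG : HasFDerivAt G D x) (v : E) :
    ⟪D v, v⟫_ℝ ≤ 0 := by
  set γ : ℝ → E := fun t => x + t • v with hγ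
  have hγ0 : γ 0 = x := by simp [hγ]
  have hγd : ∀ t, HasDerivAt γ v t := fun t => by
    simpa [hγ] using ((hasDerivAt_id t).smul_const v).const_add x
  have hφ : ∀ t, HasDerivAt (fun t => w (γ t)) ⟪G (γ t), v⟫_ℝ t := fun t => by
    have h := (hw (γ t)).hasFDerivAt.comp_hasDerivAt t (hγd t)
    rwa [InnerProductSpace.toDual_apply_apply] at h
  have hderiv : deriv (fun t => w (γ t)) = fun t => ⟪G (γ t), v⟫_ℝ := funext fun t => (hφ t).deriv
  have hG0 : HasDerivAt (fun t => G (γ t)) (D v) 0 := by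
    have hG' : HasFDerivAt G D (γ 0) := by rwa [hγ0]
    exact hG'.comp_hasDerivAt 0 (hγd 0)
  have hφ2 : deriv (deriv fun t => w (γ t)) 0 = ⟪D v, v⟫_ℝ := by
    rw [hderiv]
    simpa using (hG0.inner ℝ (hasDerivAt_const (0 : ℝ) v)).deriv
  have hmaxφ : IsLocalMax (fun t => w (γ t)) 0 := by
    have hc : Filter.Tendsto γ (𝓝 0) (𝓝 x) := by
      simpa [hγ0] using (hγd 0).continuousAt.tendsto
    filter_upwards [hc.eventually hmax] with t ht
    simpa [hγ0] using ht
  by_contra! hpos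
  have hminφ : IsLocalMin (fun t => w (γ t)) 0 :=
    isLocalMin_of_deriv_deriv_pos (by rwa [hφ2]) hmaxφ.deriv_eq_zero (hφ 0).continuousAt
  have hconst : (fun t => w (γ t)) =ᶠ[𝓝 0] fun _ => w (γ 0) := by
    filter_upwards [hmaxφ, hminφ] with t h₁ h₂ using le_antisymm h₁ h₂
  have hzero : deriv (deriv fun t => w (γ t)) 0 = 0 := by
    rw [hconst.deriv.deriv_eq]
    simp
  linarith

theorem IsLocalMax.hasGradientAt_eq_zero {w : E → ℝ} {p x : E}
    (hmax : IsLocalMax w x) (hw : HasGradientAt w p x) : p = 0 := by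
  have h := hmax.hasFDerivAt_eq_zero hw.hasFDerivAt
  simpa using h

theorem ContDiff.differentiable_gradient {f : E → ℝ} (hf : ContDiff ℝ 2 f) :
    Differentiable ℝ (gradient f) := by
  have h : Differentiable ℝ (fderiv ℝ f) :=
    (hf.fderiv_right (m := 1) (by norm_num)).differentiable (by norm_num)
  exact (InnerProductSpace.toDual ℝ E).symm.toContinuousLinearEquiv.differentiable.comp h

theorem hasGradientAt_sqrt_sq_add_norm_sq {a : ℝ} (ha : 0 < a) (x : E) :
    HasGradientAt (fun y : E => √(a ^ 2 + ‖y‖ ^ 2)) ((1 / √(a ^ 2 + ‖x‖ ^ 2)) • x) x := by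
  have h := (((hasFDerivAt_id x).norm_sq).const_add (a ^ 2)).sqrt
    (by simp only [id]; positivity)
  rw [hasGradientAt_iff_hasFDerivAt]
  refine h.congr_fderiv ?_
  ext v
  simp
  ring

end Hessian

section LorentzianDivergence

variable {m : ℕ}

/-- Expansion of `div (G / √(1 - ‖G‖²))` for a spacelike field `G`. -/
theorem sum_fderiv_lorentz_normalized {G : EuclideanSpace ℝ (Fin m) → EuclideanSpace ℝ (Fin m)}
    {D : EuclideanSpace ℝ (Fin m) →L[ℝ] EuclideanSpace ℝ (Fin m)} {x : EuclideanSpace ℝ (Fin m)}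
    (hG : HasFDerivAt G D x) (hx : ‖G x‖ < 1) :
    ∑ i : Fin m, fderiv ℝ (fun y => (1 / √(1 - ‖G y‖ ^ 2)) • G y) x
        (EuclideanSpace.single i 1) i =
      (1 / √(1 - ‖G x‖ ^ 2)) * ∑ i : Fin m, D (EuclideanSpace.single i 1) i +
        (1 / √(1 - ‖G x‖ ^ 2) ^ 3) * ⟪D (G x), G x⟫_ℝ := by
  have hpos : 0 < 1 - ‖G x‖ ^ 2 := by nlinarith [norm_nonneg (G x)]
  have hs : 0 < √(1 - ‖G x‖ ^ 2) := Real.sqrt_pos.2 hpos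
  have hV := ((hasDerivAt_inv hs.ne').comp_hasFDerivAt x
    ((hG.norm_sq.const_sub 1).sqrt hpos.ne')).smul hG
  have heq : (fun y => (1 / √(1 - ‖G y‖ ^ 2)) • G y) =
      fun y => (√(1 - ‖G y‖ ^ 2))⁻¹ • G y := by simp only [one_div]
  have hD : D (G x) = ∑ i : Fin m, G x i • D (EuclideanSpace.single i 1) := by
    conv_lhs => rw [← (EuclideanSpace.basisFun (Fin m) ℝ).sum_repr (G x)]
    simp
  rw [heq, show fderiv ℝ (fun y => (√(1 - ‖G y‖ ^ 2))⁻¹ • G y) x = _ from hV.fderiv, hD,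
    sum_inner, Finset.mul_sum, Finset.mul_sum, ← Finset.sum_add_distrib]
  refine Finset.sum_congr rfl fun i _ => ?_
  simp [inner_smul_left, real_inner_comm]
  field_simp

/-- The hyperboloid of radius `a` has mean curvature `1 / a`. -/
theorem sum_fderiv_lorentz_hyperboloid {a : ℝ} (ha : 0 < a) (x : EuclideanSpace ℝ (Fin m)) :
    ∑ i : Fin m, fderiv ℝ (fun y : EuclideanSpace ℝ (Fin m) =>
        (1 / √(1 - ‖(1 / √(a ^ 2 + ‖y‖ ^ 2)) • y‖ ^ 2)) • ((1 / √(a ^ 2 + ‖y‖ ^ 2)) • y)) x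
        (EuclideanSpace.single i 1) i = m / a := by
  have heq : (fun y : EuclideanSpace ℝ (Fin m) =>
      (1 / √(1 - ‖(1 / √(a ^ 2 + ‖y‖ ^ 2)) • y‖ ^ 2)) • ((1 / √(a ^ 2 + ‖y‖ ^ 2)) • y)) =
      fun y => (1 / a) • y := by
    funext y
    have hq : 0 < a ^ 2 + ‖y‖ ^ 2 := by positivity
    have h : 1 - ‖(1 / √(a ^ 2 + ‖y‖ ^ 2)) • y‖ ^ 2 = a ^ 2 / (a ^ 2 + ‖y‖ ^ 2) := by
      rw [norm_smul, mul_pow, Real.norm_eq_abs, sq_abs, div_pow, Real.sq_sqrt hq.le]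
      field_simp
      ring
    rw [h, Real.sqrt_div (sq_nonneg a), Real.sqrt_sq ha.le, smul_smul]
    congr 1
    have := Real.sqrt_pos.2 hq
    field_simp
  have hd : HasFDerivAt (fun y : EuclideanSpace ℝ (Fin m) => (1 / a) • y)
      ((1 / a) • ContinuousLinearMap.id ℝ _) x := (hasFDerivAt_id x).const_smul (1 / a)
  rw [heq, hd.fderiv]
  simp [div_eq_mul_inv]

/-- A spacelike graph over a ball whose slope is below that of a hyperboloid on the boundary
cannot have strictly larger mean curvature: their difference would have an interior maximum. -/
theorem exists_sum_fderiv_lorentz_le {R a b : ℝ} (hR : 0 < R) (ha : 0 < a) (hb1 : b < 1)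
    (hab : b < R / √(a ^ 2 + R ^ 2))
    {f : EuclideanSpace ℝ (Fin m) → ℝ} (hf : ContDiff ℝ 2 f)
    (hgrad : ∀ x ∈ Metric.closedBall (0 : EuclideanSpace ℝ (Fin m)) R, ‖gradient f x‖ ≤ b) :
    ∃ x ∈ Metric.closedBall (0 : EuclideanSpace ℝ (Fin m)) R,
      ∑ i : Fin m, fderiv ℝ (fun y : EuclideanSpace ℝ (Fin m) =>
          (1 / √(1 - ‖gradient f y‖ ^ 2)) • gradient f y) x (EuclideanSpace.single i 1) i
        ≤ m / a := by
  set U : EuclideanSpace ℝ (Fin m) → EuclideanSpace ℝ (Fin m) :=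
    fun y => (1 / √(a ^ 2 + ‖y‖ ^ 2)) • y with hU
  set w : EuclideanSpace ℝ (Fin m) → ℝ := fun y => f y - √(a ^ 2 + ‖y‖ ^ 2) with hw
  have hwG : ∀ y, HasGradientAt w (gradient f y - U y) y := fun y => by
    have h₁ := ((hf.differentiable (by norm_num)) y).hasGradientAt.hasFDerivAt
    have h₂ := (hasGradientAt_sqrt_sq_add_norm_sq ha y).hasFDerivAt
    rw [hasGradientAt_iff_hasFDerivAt, map_sub]
    exact h₁.sub h₂
  have hwc : Continuous w :=
    continuous_iff_continuousAt.2 fun y => (hwG y).hasFDerivAt.continuousAt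
  obtain ⟨x, hxB, hxmax⟩ := (isCompact_closedBall (0 : EuclideanSpace ℝ (Fin m)) R).exists_isMaxOn
    (Metric.nonempty_closedBall.2 hR.le) hwc.continuousOn
  refine ⟨x, hxB, ?_⟩
  have hxR : ‖x‖ < R := by
    refine lt_of_le_of_ne (by simpa using hxB) fun hEq => ?_
    have hseg : segment ℝ x 0 ⊆ Metric.closedBall (0 : EuclideanSpace ℝ (Fin m)) R :=
      (convex_closedBall _ _).segment_subset hxB (Metric.mem_closedBall_self hR.le)
    have h := hxmax.localize.hasFDerivWithinAt_nonpos (hwG x).hasFDerivAt.hasFDerivWithinAt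
      (sub_mem_posTangentConeAt_of_segment_subset hseg)
    have hUx : ⟪U x, x⟫_ℝ = R / √(a ^ 2 + R ^ 2) * R := by
      rw [hU]
      simp only [inner_smul_left, real_inner_self_eq_norm_sq, hEq]
      simp
      ring
    have hfx : ⟪gradient f x, x⟫_ℝ ≤ b * R :=
      (real_inner_le_norm _ _).trans
        (by rw [hEq]; exact mul_le_mul_of_nonneg_right (hgrad x hxB) hR.le)
    simp only [zero_sub, map_neg, InnerProductSpace.toDual_apply_apply, inner_sub_left, hUx] at h
    nlinarith
  have hloc : IsLocalMax w x :=
    hxmax.isLocalMax (mem_nhds_iff.2 ⟨_, Metric.ball_subset_closedBall, Metric.isOpen_ball,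
      by simpa using hxR⟩)
  have hp : U x = gradient f x := (sub_eq_zero.1 (hloc.hasGradientAt_eq_zero (hwG x))).symm
  have hfD := (hf.differentiable_gradient x).hasFDerivAt
  have hUdiff : DifferentiableAt ℝ U x := by
    have hq : a ^ 2 + ‖x‖ ^ 2 ≠ 0 := by positivity
    have hn : DifferentiableAt ℝ (fun y : EuclideanSpace ℝ (Fin m) => √(a ^ 2 + ‖y‖ ^ 2)) x :=
      (hasGradientAt_sqrt_sq_add_norm_sq ha x).differentiableAt
    have hne : √(a ^ 2 + ‖x‖ ^ 2) ≠ 0 := by positivity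
    simp only [hU, one_div]
    exact (hn.inv hne).smul differentiableAt_id
  have hUD := hUdiff.hasFDerivAt
  have hneg := hloc.inner_fderiv_gradient_nonpos hwG (hfD.sub hUD)
  have hlt : ‖gradient f x‖ < 1 := (hgrad x hxB).trans_lt hb1
  have hF := sum_fderiv_lorentz_normalized hfD hlt
  have hUF := sum_fderiv_lorentz_normalized hUD (by rwa [hp])
  rw [hp] at hUF
  have hUm : _ = (m : ℝ) / a := sum_fderiv_lorentz_hyperboloid ha x
  rw [← hUm, hF]
  refine le_trans ?_ hUF.ge
  have htrace : ∑ i : Fin m, fderiv ℝ (gradient f) x (EuclideanSpace.single i 1) i ≤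
      ∑ i : Fin m, fderiv ℝ U x (EuclideanSpace.single i 1) i := by
    refine Finset.sum_le_sum fun i _ => ?_
    have h := hneg (EuclideanSpace.single i 1)
    simp [EuclideanSpace.inner_single_right] at h
    linarith
  have hquad : ⟪fderiv ℝ (gradient f) x (gradient f x), gradient f x⟫_ℝ ≤
      ⟪fderiv ℝ U x (gradient f x), gradient f x⟫_ℝ := by
    have h := hneg (gradient f x)
    rw [sub_apply, inner_sub_left] at h
    linarith
  gcongr

theorem lorentz_heinz_bound (hm : 1 ≤ m) {R c b : ℝ} (hR : 0 < R)
    (hb0 : 0 ≤ b) (hb1 : b < 1)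
    {f : EuclideanSpace ℝ (Fin m) → ℝ} (hf : ContDiff ℝ 2 f)
    (hgrad : ∀ x ∈ Metric.closedBall (0 : EuclideanSpace ℝ (Fin m)) R, ‖gradient f x‖ ≤ b)
    (hdiv : ∀ x ∈ Metric.closedBall (0 : EuclideanSpace ℝ (Fin m)) R,
      (m : ℝ) * c ≤ ∑ i : Fin m,
        fderiv ℝ (fun y : EuclideanSpace ℝ (Fin m) =>
            (1 / √(1 - ‖gradient f y‖ ^ 2)) • gradient f y) x (EuclideanSpace.single i 1) i) :
    c ≤ b / (R * √(1 - b ^ 2)) := by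
  have hb2 : 0 < 1 - b ^ 2 := by nlinarith
  have hs := Real.sqrt_pos.2 hb2
  have hs2 := Real.sq_sqrt hb2.le
  by_contra! hlt
  obtain ⟨d, hd₁, hd₂⟩ := exists_between hlt
  have hd : 0 < d := lt_of_le_of_lt (by positivity) hd₁
  rw [div_lt_iff₀ (by positivity)] at hd₁
  have hab : b < R / √((1 / d) ^ 2 + R ^ 2) := by
    rw [lt_div_iff₀ (by positivity)]
    refine lt_of_pow_lt_pow_left₀ 2 hR.le ?_
    rw [mul_pow, Real.sq_sqrt (by positivity)]
    have h : (b / d) ^ 2 < (R * √(1 - b ^ 2)) ^ 2 := by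
      refine pow_lt_pow_left₀ ?_ (by positivity) two_ne_zero
      rw [div_lt_iff₀ hd]
      linarith
    rw [mul_pow, hs2] at h
    have e : b ^ 2 * ((1 / d) ^ 2 + R ^ 2) = (b / d) ^ 2 + b ^ 2 * R ^ 2 := by ring
    rw [e]
    linarith
  obtain ⟨x, hx, hle⟩ := exists_sum_fderiv_lorentz_le hR (by positivity) hb1 hab hf hgrad
  have h := (hdiv x hx).trans hle
  have hm' : (0 : ℝ) < m := by exact_mod_cast hm
  rw [div_div_eq_mul_div, div_one] at h
  nlinarith

theorem entire_lorentz_mean_curvature_nonpos (hm : 1 ≤ m) {b K : ℝ} (hb0 : 0 ≤ b) (hb1 : b < 1)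
    {g : EuclideanSpace ℝ (Fin m) → ℝ} (hg : ContDiff ℝ 2 g)
    (hgrad : ∀ x, ‖gradient g x‖ ≤ b)
    (hdiv : ∀ x : EuclideanSpace ℝ (Fin m),
      (∑ i : Fin m, fderiv ℝ (fun y : EuclideanSpace ℝ (Fin m) =>
        (1 / √(1 - ‖gradient g y‖ ^ 2)) • gradient g y) x (EuclideanSpace.single i 1) i) = K) :
    K ≤ 0 := by
  by_contra! hK
  have hm' : (0 : ℝ) < m := by exact_mod_cast hm
  have hs : 0 < √(1 - b ^ 2) := Real.sqrt_pos.2 (by nlinarith)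
  have hR : 0 < (b + 1) / (K / m * √(1 - b ^ 2)) := by positivity
  have h := lorentz_heinz_bound hm hR hb0 hb1 hg (fun x _ => hgrad x)
    (fun x _ => by rw [hdiv x, mul_div_cancel₀ _ hm'.ne'])
  rw [le_div_iff₀ (by positivity)] at h
  have e : K / m * ((b + 1) / (K / m * √(1 - b ^ 2)) * √(1 - b ^ 2)) = b + 1 := by
    field_simp
  linarith

end LorentzianDivergence

/-- Lorentzian Heinz–Chern–Flanders: if `f : ℝ^m → ℝ` is `C²` with `‖∇f‖ ≤ b < 1`
on the closed ball of radius `R` about `0` (spacelike graph) and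
`div(∇f/√(1-‖∇f‖²)) ≥ m c > 0` there, then `c ≤ b/(R √(1-b²))`. Consequently, an
entire `C²` spacelike graph with `sup ‖∇g‖ ≤ b < 1` and
`div(∇g/√(1-‖∇g‖²))` constant equal to `K` has `K = 0`, i.e. it is maximal. -/
theorem stmt_19 (m : ℕ) (hm : 1 ≤ m) (R c b : ℝ) (hR : 0 < R) (hc : 0 < c)
    (hb0 : 0 ≤ b) (hb1 : b < 1)
    (f : EuclideanSpace ℝ (Fin m) → ℝ) (hf : ContDiff ℝ 2 f)
    (hgrad : ∀ x ∈ Metric.closedBall (0 : EuclideanSpace ℝ (Fin m)) R,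
      ‖gradient f x‖ ≤ b)
    (hdiv : ∀ x ∈ Metric.closedBall (0 : EuclideanSpace ℝ (Fin m)) R,
      (m : ℝ) * c ≤ ∑ i : Fin m,
        fderiv ℝ (fun y : EuclideanSpace ℝ (Fin m) =>
            (1 / Real.sqrt (1 - ‖gradient f y‖ ^ 2)) • gradient f y)
          x (EuclideanSpace.single i 1) i) :
    c ≤ b / (R * Real.sqrt (1 - b ^ 2)) ∧
      ∀ (g : EuclideanSpace ℝ (Fin m) → ℝ) (K : ℝ), ContDiff ℝ 2 g →
        (∀ x : EuclideanSpace ℝ (Fin m), ‖gradient g x‖ ≤ b) →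
        (∀ x : EuclideanSpace ℝ (Fin m),
          (∑ i : Fin m,
            fderiv ℝ (fun y : EuclideanSpace ℝ (Fin m) =>
                (1 / Real.sqrt (1 - ‖gradient g y‖ ^ 2)) • gradient g y)
              x (EuclideanSpace.single i 1) i) = K) →
        K = 0 := by
  refine ⟨lorentz_heinz_bound hm hR hb0 hb1 hf hgrad hdiv, fun g K hg hgg hgd => ?_⟩
  refine le_antisymm (entire_lorentz_mean_curvature_nonpos hm hb0 hb1 hg hgg hgd) ?_
  have hneg : ∀ x, gradient (fun y => -g y) x = -gradient g x := fun x => by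
    simp [gradient]
  have h := entire_lorentz_mean_curvature_nonpos (K := -K) hm hb0 hb1 hg.neg
    (fun x => by rw [hneg, norm_neg]; exact hgg x)
    (fun x => by
      simp only [hneg, norm_neg, smul_neg, fderiv_fun_neg, neg_apply,
        PiLp.neg_apply, Finset.sum_neg_distrib, hgd x])
  linarith
end
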